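/- Let l ≥ 3 be odd and s ≥ 3, and let G(s,l) be the graph consisting of a cycle of length s together with s pairwise vertex-disjoint cycles of length l, the i-th of which shares exactly one vertex with the central cycle, namely its i-th vertex. Then the Graver basis of I_{G(s,l)} contains a binomial of degree s(l+1)/2 (namely B_w for the closed walk w traversing every edge of G(s,l) exactly once), while every circuit of I_{G(s,l)} has degree at most l + s − 1; since s, l ≥ 3 we have s(l+1)/2 > l + s − 1, so the maximal Graver degree strictly exceeds the degree of every circuit. -/

import Mathlib

open MvPolynomial

noncomputable section

/-! ### Term orders, initial terms, (reduced) Gröbner bases, universal Gröbner basis -/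

/-- A term order on the monomials (exponent vectors) in variables indexed by `σ`:
a linear order for which `0` is least and which is compatible with addition. -/
structure TermOrder (σ : Type*) where
  lo : LinearOrder (σ →₀ ℕ)
  zero_min : ∀ u : σ →₀ ℕ, lo.le 0 u
  add_right : ∀ u v w : σ →₀ ℕ, lo.le u v → lo.le (u + w) (v + w)

variable {σ : Type*} {K : Type*} [Field K]

/-- The leading (largest) exponent of a polynomial with respect to a term order
(junk value `0` if `f = 0`). -/
def TermOrder.leadExp (t : TermOrder σ) (f : MvPolynomial σ K) : σ →₀ ℕ :=
  haveI := Classical.propDecidable (f = 0)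
  if h : f = 0 then 0
  else @Finset.max' _ t.lo f.support
    (Finset.nonempty_iff_ne_empty.mpr fun he => h (MvPolynomial.support_eq_empty.mp he))

/-- The initial term of a polynomial with respect to a term order. -/
def TermOrder.initial (t : TermOrder σ) (f : MvPolynomial σ K) : MvPolynomial σ K :=
  monomial (t.leadExp f) (f.coeff (t.leadExp f))

/-- `𝒢` is a Gröbner basis of `I` w.r.t. the term order `t`. -/
def IsGroebnerBasis (t : TermOrder σ) (I : Ideal (MvPolynomial σ K))
    (𝒢 : Finset (MvPolynomial σ K)) : Prop :=
  (𝒢 : Set (MvPolynomial σ K)) ⊆ (I : Set (MvPolynomial σ K)) ∧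
    Ideal.span (t.initial '' (𝒢 : Set (MvPolynomial σ K))) =
      Ideal.span (t.initial '' (I : Set (MvPolynomial σ K)))

/-- `𝒢` is a reduced Gröbner basis of `I` w.r.t. `t`: a Gröbner basis, all of whose elements
are monic, and no monomial occurring in an element of `𝒢` is divisible by the initial term of
a different element of `𝒢`. -/
def IsReducedGroebnerBasis (t : TermOrder σ) (I : Ideal (MvPolynomial σ K))
    (𝒢 : Finset (MvPolynomial σ K)) : Prop :=
  IsGroebnerBasis t I 𝒢 ∧
    (∀ g ∈ 𝒢, g.coeff (t.leadExp g) = 1) ∧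
    (∀ g ∈ 𝒢, ∀ g' ∈ 𝒢, g' ≠ g → ∀ u ∈ g.support, ¬ t.leadExp g' ≤ u)

/-- The universal Gröbner basis of `I`: the union of all reduced Gröbner bases of `I`
over all term orders. -/
def UniversalGB (I : Ideal (MvPolynomial σ K)) : Set (MvPolynomial σ K) :=
  {f | ∃ (t : TermOrder σ) (𝒢 : Finset (MvPolynomial σ K)),
    IsReducedGroebnerBasis t I 𝒢 ∧ f ∈ 𝒢}

/-! ### Binomials, primitive binomials (Graver basis), circuits -/

/-- The binomial `x^u - x^v`. -/
def binom (K : Type*) [Field K] {σ : Type*} (u v : σ →₀ ℕ) : MvPolynomial σ K :=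
  monomial u 1 - monomial v 1

/-- `f` is a primitive binomial of `I`: `f = x^u - x^v ∈ I` and there is no other binomial
`x^w - x^z ∈ I` with `x^w ∣ x^u` and `x^z ∣ x^v`.  The set of primitive binomials of `I`
is the Graver basis of `I`. -/
def IsPrimitiveBinomial (I : Ideal (MvPolynomial σ K)) (f : MvPolynomial σ K) : Prop :=
  ∃ u v : σ →₀ ℕ, u ≠ v ∧ f = binom K u v ∧ f ∈ I ∧
    ∀ w z : σ →₀ ℕ, w ≠ z → binom K w z ∈ I → w ≤ u → z ≤ v → w = u ∧ z = v

/-- `f` is a circuit of `I`: an irreducible binomial of `I` whose support (set of variables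
occurring in it) is minimal among the supports of nonzero binomials of `I`. -/
def IsCircuitBinomial (I : Ideal (MvPolynomial σ K)) (f : MvPolynomial σ K) : Prop :=
  (∃ u v : σ →₀ ℕ, u ≠ v ∧ f = binom K u v) ∧ f ∈ I ∧ Irreducible f ∧
    ∀ g : MvPolynomial σ K, (∃ u v : σ →₀ ℕ, u ≠ v ∧ g = binom K u v) → g ∈ I →
      g.vars ⊆ f.vars → g.vars = f.vars

/-- The toric ideal of a vector configuration `A = (a_1, …, a_m) ⊆ ℕ^n`: the ideal generated
by all binomials `x^u - x^v` with `Σ uᵢ aᵢ = Σ vᵢ aᵢ`. -/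
def toricIdealOfConfig (K : Type*) [Field K] {m n : ℕ} (A : Fin m → Fin n → ℕ) :
    Ideal (MvPolynomial (Fin m) K) :=
  Ideal.span {f | ∃ u v : Fin m →₀ ℕ,
    f = binom K u v ∧ (∑ i, u i • A i) = ∑ i, v i • A i}

/-! ### Toric ideals of graphs -/

variable {V : Type*}

/-- The image `x_u * x_v` of an edge `e = {u, v}`. -/
def edgeImage (K : Type*) [Field K] {V : Type*} (e : Sym2 V) : MvPolynomial V K :=
  Sym2.lift ⟨fun a b => X a * X b, fun a b => mul_comm _ _⟩ e

/-- The toric ideal `I_G` of a graph `G`: the kernel of the `K`-algebra map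
`K[e : e ∈ E(G)] → K[x_v : v ∈ V(G)]`, `e = {u,v} ↦ x_u x_v`. -/
def graphToricIdeal (K : Type*) [Field K] (G : SimpleGraph V) :
    Ideal (MvPolynomial G.edgeSet K) :=
  RingHom.ker (MvPolynomial.aeval
    (fun e : G.edgeSet => edgeImage K (e : Sym2 V)) :
      MvPolynomial G.edgeSet K →ₐ[K] MvPolynomial V K).toRingHom

/-- An even closed walk `(v_0, v_1, …, v_{2q} = v_0)` in a graph `G`;
edges and vertices may repeat. -/
structure EvenClosedWalk (G : SimpleGraph V) where
  q : ℕ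
  verts : ℕ → V
  adj : ∀ i, i < 2 * q → G.Adj (verts i) (verts (i + 1))
  closed : verts (2 * q) = verts 0

namespace EvenClosedWalk

variable {G : SimpleGraph V}

/-- The `i`-th edge of the walk, as an element of the edge set of `G`. -/
def edge (w : EvenClosedWalk G) (i : ℕ) (h : i < 2 * w.q) : G.edgeSet :=
  ⟨s(w.verts i, w.verts (i + 1)), w.adj i h⟩

/-- The exponent vector `w⁺` of the monomial `E⁺(w)`, the product of the edges of `w`
in odd position (`1`-indexed). -/
def plusExp (w : EvenClosedWalk G) : G.edgeSet →₀ ℕ :=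
  ∑ k : Fin w.q, Finsupp.single (w.edge (2 * (k : ℕ)) (by have := k.isLt; omega)) 1

/-- The exponent vector `w⁻` of the monomial `E⁻(w)`, the product of the edges of `w`
in even position (`1`-indexed). -/
def minusExp (w : EvenClosedWalk G) : G.edgeSet →₀ ℕ :=
  ∑ k : Fin w.q, Finsupp.single (w.edge (2 * (k : ℕ) + 1) (by have := k.isLt; omega)) 1

end EvenClosedWalk

/-- The monomial `E⁺(w)`. -/
def Eplus (K : Type*) [Field K] {G : SimpleGraph V} (w : EvenClosedWalk G) :
    MvPolynomial G.edgeSet K :=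
  monomial w.plusExp 1

/-- The monomial `E⁻(w)`. -/
def Eminus (K : Type*) [Field K] {G : SimpleGraph V} (w : EvenClosedWalk G) :
    MvPolynomial G.edgeSet K :=
  monomial w.minusExp 1

/-- The binomial `B_w = E⁺(w) - E⁻(w)` of an even closed walk. -/
def Bw (K : Type*) [Field K] {G : SimpleGraph V} (w : EvenClosedWalk G) :
    MvPolynomial G.edgeSet K :=
  binom K w.plusExp w.minusExp

namespace EvenClosedWalk

variable {G : SimpleGraph V}

/-- The number of positions of the walk at which the edge `e` appears. -/
def count [DecidableEq V] (w : EvenClosedWalk G) (e : Sym2 V) : ℕ :=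
  ((Finset.range (2 * w.q)).filter fun i => e = s(w.verts i, w.verts (i + 1))).card

/-- The subgraph `𝐰` of `G` spanned by the edges of the walk `w`. -/
def graph (w : EvenClosedWalk G) : SimpleGraph V :=
  SimpleGraph.fromEdgeSet {e | ∃ i, ∃ _ : i < 2 * w.q, e = s(w.verts i, w.verts (i + 1))}

/-- The set `w⁺` of edges of `w` in odd position (`1`-indexed). -/
def plusEdges (w : EvenClosedWalk G) : Set (Sym2 V) :=
  {e | ∃ k, ∃ _ : k < w.q, e = s(w.verts (2 * k), w.verts (2 * k + 1))}

/-- The set `w⁻` of edges of `w` in even position (`1`-indexed). -/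
def minusEdges (w : EvenClosedWalk G) : Set (Sym2 V) :=
  {e | ∃ k, ∃ _ : k < w.q, e = s(w.verts (2 * k + 1), w.verts (2 * k + 2))}

/-- An even closed walk is primitive if it is nontrivial and there is no even closed
subwalk `ξ` of smaller length with `E⁺(ξ) ∣ E⁺(w)` and `E⁻(ξ) ∣ E⁻(w)`. -/
def IsPrimitive (w : EvenClosedWalk G) : Prop :=
  0 < w.q ∧ ∀ ξ : EvenClosedWalk G, 0 < ξ.q → ξ.q < w.q →
    ¬(ξ.plusExp ≤ w.plusExp ∧ ξ.minusExp ≤ w.minusExp)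

/-- The walk `w` is a cycle: it visits no vertex twice. -/
def IsCycle (w : EvenClosedWalk G) : Prop :=
  2 ≤ w.q ∧ ∀ i j, i < 2 * w.q → j < 2 * w.q → w.verts i = w.verts j → i = j

end EvenClosedWalk

/-! ### Cut vertices, cut edges, blocks, sinks -/

/-- `v` is a cut vertex of `H`: removing `v` (and the edges through it) disconnects two
vertices different from `v` that were connected in `H`. -/
def IsCutVertex (H : SimpleGraph V) (v : V) : Prop :=
  ∃ a b, a ≠ v ∧ b ≠ v ∧ H.Reachable a b ∧
    ¬(SimpleGraph.fromEdgeSet {e | e ∈ H.edgeSet ∧ v ∉ e}).Reachable a b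

/-- `e` is a cut edge of `H`: removing it disconnects two vertices connected in `H`. -/
def IsCutEdge (H : SimpleGraph V) (e : Sym2 V) : Prop :=
  e ∈ H.edgeSet ∧ ∃ a b, H.Reachable a b ∧ ¬(H.deleteEdges {e}).Reachable a b

/-- `H` is biconnected: it has an edge, it is connected (on its support),
and it has no cut vertex. -/
def IsBiconnected (H : SimpleGraph V) : Prop :=
  H.edgeSet.Nonempty ∧ (∀ a ∈ H.support, ∀ b ∈ H.support, H.Reachable a b) ∧
    ∀ v, ¬IsCutVertex H v

/-- `B` is a block of `H`: a maximal biconnected subgraph. -/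
def IsBlock (H B : SimpleGraph V) : Prop :=
  B ≤ H ∧ IsBiconnected B ∧ ∀ B', B ≤ B' → B' ≤ H → IsBiconnected B' → B' = B

/-- A graph is a cycle (graph): its edge set is the edge set of a cycle of length `≥ 3`. -/
def IsCycleGraph (B : SimpleGraph V) : Prop :=
  ∃ (n : ℕ) (f : ℕ → V), 3 ≤ n ∧
    (∀ i j, i < n → j < n → f i = f j → i = j) ∧
    B.edgeSet = {e | ∃ i, ∃ _ : i < n, e = s(f i, f ((i + 1) % n))}

/-- `v` is a sink of the block `B` of the walk `w`: a common vertex of two odd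
(or two even) edges of the walk belonging to `B`. -/
def IsSinkOf {G : SimpleGraph V} (w : EvenClosedWalk G) (B : SimpleGraph V) (v : V) : Prop :=
  ∃ e₁ e₂ : Sym2 V, e₁ ≠ e₂ ∧ e₁ ∈ B.edgeSet ∧ e₂ ∈ B.edgeSet ∧ v ∈ e₁ ∧ v ∈ e₂ ∧
    ((e₁ ∈ w.plusEdges ∧ e₂ ∈ w.plusEdges) ∨ (e₁ ∈ w.minusEdges ∧ e₂ ∈ w.minusEdges))

/-- `B` is a pure cyclic block of the walk `w`: a block of `𝐰` which is a cycle all of whose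
edges lie in `w⁺`, or all in `w⁻`. -/
def IsPureCyclicBlock {G : SimpleGraph V} (w : EvenClosedWalk G) (B : SimpleGraph V) : Prop :=
  IsBlock w.graph B ∧ IsCycleGraph B ∧
    (B.edgeSet ⊆ w.plusEdges ∨ B.edgeSet ⊆ w.minusEdges)

/-- A primitive walk is mixed if it has no pure cyclic block. -/
def EvenClosedWalk.IsMixed {G : SimpleGraph V} (w : EvenClosedWalk G) : Prop :=
  ∀ B : SimpleGraph V, ¬IsPureCyclicBlock w B


/-- The graph `G(s, l)`: a central cycle of length `s` (on the vertices `(i, 0)`), together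
with `s` pairwise vertex-disjoint cycles of length `l` (the `i`-th on the vertices `(i, j)`),
the `i`-th of which meets the central cycle exactly in its `i`-th vertex `(i, 0)`. -/
def Gsl (s l : ℕ) : SimpleGraph (ZMod s × ZMod l) :=
  SimpleGraph.fromEdgeSet
    ({e | ∃ i : ZMod s, e = s((i, (0 : ZMod l)), (i + 1, (0 : ZMod l)))} ∪
     {e | ∃ (i : ZMod s) (j : ZMod l), e = s((i, j), (i, j + 1))})

section Binomials

theorem support_binom [DecidableEq σ] {u v : σ →₀ ℕ} (h : u ≠ v) :
    (binom K u v).support = {u, v} := by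
  classical
  ext w
  rw [mem_support_iff, binom, coeff_sub, coeff_monomial, coeff_monomial]
  by_cases h1 : u = w <;> by_cases h2 : v = w <;> simp_all [eq_comm]

theorem mem_vars_binom {u v : σ →₀ ℕ} (h : u ≠ v) (e : σ) :
    e ∈ (binom K u v).vars ↔ u e ≠ 0 ∨ v e ≠ 0 := by
  classical
  simp [mem_vars_iff_mem_support, support_binom h]

theorem totalDegree_binom {u v : σ →₀ ℕ} (h : u ≠ v) :
    (binom K u v).totalDegree = max (u.sum fun _ n => n) (v.sum fun _ n => n) := by
  classical
  simp [totalDegree, support_binom h]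

theorem binom_dvd_binom {u v a b : σ →₀ ℕ} (k : ℕ) (ha : k • a ≤ u)
    (h : u + k • b = v + k • a) : binom K a b ∣ binom K u v := by
  have hv : v = (u - k • a) + k • b := by
    ext e
    have h1 := DFunLike.congr_fun h e
    have h2 := ha e
    simp only [Finsupp.coe_add, Finsupp.coe_smul, Pi.add_apply, Pi.smul_apply, smul_eq_mul,
      Finsupp.coe_tsub, Pi.sub_apply] at h1 h2 ⊢
    omega
  have hu : u = (u - k • a) + k • a := (tsub_add_cancel_of_le ha).symm
  have key : binom K u v = monomial (u - k • a) 1 *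
      ((monomial a (1 : K)) ^ k - (monomial b 1) ^ k) := by
    rw [monomial_pow, monomial_pow, mul_sub, monomial_mul, monomial_mul, one_pow, one_mul,
      ← hu, ← hv, binom]
  rw [key]
  exact Dvd.dvd.mul_left (sub_dvd_pow_sub_pow _ _ k) _

/-- The exponent vector of the positive part of an integer vector. -/
def posExp [Fintype σ] (d : σ → ℤ) : σ →₀ ℕ :=
  Finsupp.equivFunOnFinite.symm fun e => (d e).toNat

theorem posExp_apply [Fintype σ] (d : σ → ℤ) (e : σ) : posExp d e = (d e).toNat := rfl

theorem posExp_ne_posExp_neg [Fintype σ] {d : σ → ℤ} (hd : d ≠ 0) :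
    posExp d ≠ posExp (-d) := by
  intro h
  apply hd
  ext e
  have := DFunLike.congr_fun h e
  simp only [posExp_apply, Pi.neg_apply, Pi.zero_apply] at this ⊢
  omega

theorem totalDegree_binom_posExp_le [Fintype σ] {d : σ → ℤ} (hd : d ≠ 0) (h0 : ∑ e, d e = 0)
    {n : ℕ} (hn : ∑ e, |d e| ≤ 2 * n) :
    (binom K (posExp d) (posExp (-d))).totalDegree ≤ n := by
  rw [totalDegree_binom (posExp_ne_posExp_neg hd), Finsupp.sum_fintype _ _ (fun _ => rfl),
    Finsupp.sum_fintype _ _ (fun _ => rfl)]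
  have h1 : ∑ e, d e = ((∑ e, posExp d e : ℕ) : ℤ) - ((∑ e, posExp (-d) e : ℕ) : ℤ) := by
    push_cast
    rw [← Finset.sum_sub_distrib]
    refine Finset.sum_congr rfl fun e _ => ?_
    simp only [posExp_apply, Pi.neg_apply]
    omega
  have h2 : ∑ e, |d e| = ((∑ e, posExp d e : ℕ) : ℤ) + ((∑ e, posExp (-d) e : ℕ) : ℤ) := by
    push_cast
    rw [← Finset.sum_add_distrib]
    refine Finset.sum_congr rfl fun e _ => ?_
    simp only [posExp_apply, Pi.neg_apply]
    rcases abs_cases (d e) with h | h <;> omega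
  omega

/-- If `I` contains a binomial exactly when the difference of its exponent vectors lies in the
lattice `L`, then the degree of a circuit with difference vector `d` is at most that of any
lattice vector whose support is contained in that of `d` and which has a unit entry. -/
theorem IsCircuitBinomial.exists_totalDegree_le [Fintype σ] {I : Ideal (MvPolynomial σ K)}
    (hI : I ≠ ⊤) {L : AddSubgroup (σ → ℤ)}
    (hL : ∀ u v : σ →₀ ℕ, binom K u v ∈ I ↔ (fun e => (u e : ℤ) - v e) ∈ L)
    {f : MvPolynomial σ K} (hf : IsCircuitBinomial I f) :
    ∃ d ∈ L, d ≠ 0 ∧ ∀ h ∈ L, (∀ e, d e = 0 → h e = 0) → (∃ e, |h e| = 1) →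
      f.totalDegree ≤ (binom K (posExp h) (posExp (-h))).totalDegree := by
  obtain ⟨⟨u, v, huv, rfl⟩, hfI, hirr, hmin⟩ := hf
  have hpos : ∀ h : σ → ℤ, h ∈ L → binom K (posExp h) (posExp (-h)) ∈ I := by
    intro h hh
    rw [hL]
    convert hh using 1
    ext e
    simp only [posExp_apply, Pi.neg_apply]
    omega
  set d : σ → ℤ := fun e => (u e : ℤ) - v e with hd
  have hdL : d ∈ L := (hL u v).1 hfI
  have hd0 : d ≠ 0 := by
    intro h
    apply huv
    ext e
    have := congrFun h e
    simp only [hd, Pi.zero_apply] at this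
    omega
  have hvars : ∀ h : σ → ℤ, h ∈ L → h ≠ 0 → (∀ e, d e = 0 → h e = 0) →
      (binom K (posExp h) (posExp (-h))).vars = (binom K u v).vars := by
    intro h hh h0 hs
    refine hmin _ ⟨_, _, posExp_ne_posExp_neg h0, rfl⟩ (hpos h hh) fun e he => ?_
    rw [mem_vars_binom (posExp_ne_posExp_neg h0)] at he
    rw [mem_vars_binom huv]
    have := hs e
    simp only [posExp_apply, Pi.neg_apply, hd] at he this
    omega
  have hsupp : ∀ h : σ → ℤ, h ∈ L → h ≠ 0 → (∀ e, d e = 0 → h e = 0) →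
      ∀ e, h e = 0 → d e = 0 := by
    intro h hh h0 hs e he
    by_contra hde
    have h1 : e ∈ (binom K (posExp d) (posExp (-d))).vars := by
      rw [mem_vars_binom (posExp_ne_posExp_neg hd0)]
      simp only [posExp_apply, Pi.neg_apply]
      omega
    rw [hvars d hdL hd0 fun _ h => h, ← hvars h hh h0 hs,
      mem_vars_binom (posExp_ne_posExp_neg h0)] at h1
    simp [posExp_apply, he] at h1
  refine ⟨d, hdL, hd0, fun h hh hs ⟨e₀, he₀⟩ => ?_⟩
  have h0 : h ≠ 0 := by
    rintro rfl
    simp at he₀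
  have hde₀ : d e₀ ≠ 0 := by
    intro H
    rw [hs e₀ H] at he₀
    simp at he₀
  have hr : h e₀ • d - d e₀ • h = 0 := by
    by_contra hr
    exact hde₀ (hsupp _ (L.sub_mem (L.zsmul_mem hdL _) (L.zsmul_mem hh _)) hr
      (fun e he => by simp [he, hs e he]) e₀ (by simp [mul_comm]))
  obtain ⟨k, hk⟩ : ∃ k : ℤ, ∀ e, d e = k * h e := by
    have hsq : h e₀ * h e₀ = 1 := by rw [← abs_mul_abs_self, he₀, one_mul]
    refine ⟨h e₀ * d e₀, fun e => ?_⟩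
    have := congrFun hr e
    simp only [Pi.sub_apply, Pi.smul_apply, smul_eq_mul, Pi.zero_apply] at this
    linear_combination h e₀ * this - d e * hsq
  have hdvd : binom K (posExp h) (posExp (-h)) ∣ binom K u v := by
    have aux : ∀ (u v : σ →₀ ℕ) (n : ℕ), (∀ e, (u e : ℤ) - v e = n * h e) →
        binom K (posExp h) (posExp (-h)) ∣ binom K u v := by
      intro u v n hn
      have hn' : ∀ e, u e + n * (-h e).toNat = v e + n * (h e).toNat := by
        intro e
        zify
        have : h e = ((h e).toNat : ℤ) - ((-h e).toNat : ℤ) := by omega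
        linear_combination hn e + n * this
      refine binom_dvd_binom n (fun e => ?_) (Finsupp.ext fun e => ?_)
      · have := hn' e
        simp only [Finsupp.coe_smul, Pi.smul_apply, smul_eq_mul, posExp_apply]
        rcases le_total 0 (h e) with h1 | h1
        · rw [Int.toNat_of_nonpos (by omega : -h e ≤ 0)] at this
          omega
        · rw [Int.toNat_of_nonpos h1]
          simp
      · simpa [posExp_apply] using hn' e
    obtain ⟨n, rfl | rfl⟩ := k.eq_nat_or_neg
    · exact aux u v n hk
    · rw [show binom K u v = -binom K v u by simp [binom], dvd_neg]
      refine aux v u n fun e => ?_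
      have := hk e
      simp only [hd] at this
      linarith
  have hnu : ¬IsUnit (binom K (posExp h) (posExp (-h))) := fun H =>
    hI (Ideal.eq_top_of_isUnit_mem _ (hpos h hh) H)
  have hne : binom K (posExp h) (posExp (-h)) ≠ 0 := by
    rintro H
    rw [H, zero_dvd_iff] at hdvd
    exact hirr.ne_zero hdvd
  obtain ⟨q, hq⟩ := hdvd
  have hqu : IsUnit q := (hirr.isUnit_or_isUnit hq).resolve_left hnu
  refine totalDegree_le_of_dvd_of_isDomain ?_ hne
  rw [hq]
  exact (hqu.mul_right_dvd).2 dvd_rfl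

end Binomials

section CyclicSequences

theorem ZMod.val_sub_one_of_ne_zero {n : ℕ} [NeZero n] {x : ZMod n} (hx : x ≠ 0) :
    (x - 1).val = x.val - 1 := by
  have h1 : x.val ≠ 0 := (ZMod.val_ne_zero x).2 hx
  have h2 := x.val_lt
  have : x - 1 = ((x.val - 1 : ℕ) : ZMod n) := by
    rw [Nat.cast_sub (by omega), ZMod.natCast_zmod_val, Nat.cast_one]
  rw [this, ZMod.val_natCast_of_lt (by omega)]

theorem ZMod.val_zero_sub_one {n : ℕ} [NeZero n] : ((0 : ZMod n) - 1).val = n - 1 := by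
  have h := Nat.pos_of_ne_zero (NeZero.ne n)
  have : (0 : ZMod n) - 1 = ((n - 1 : ℕ) : ZMod n) := by
    rw [Nat.cast_sub (by omega), ZMod.natCast_self, Nat.cast_one]
  rw [this, ZMod.val_natCast_of_lt (by omega)]

theorem ZMod.induction_add_one {n : ℕ} [NeZero n] {P : ZMod n → Prop} (a : ZMod n) (ha : P a)
    (h : ∀ i, P i → P (i + 1)) (i : ZMod n) : P i := by
  have key : ∀ k : ℕ, P (a + k) := by
    intro k
    induction k with
    | zero => simpa using ha
    | succ k ih =>
      rw [Nat.cast_succ, ← add_assoc]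
      exact h _ ih
  simpa using key (i - a).val

/-- `(g, c)` describes a vector of the lattice of `Gsl s l`: `g` lists the values on the edges of
the central cycle and `c i` is the value, up to sign, on the edges of the `i`-th outer cycle. -/
def IsBalanced {s : ℕ} (g c : ZMod s → ℤ) : Prop :=
  ∀ i, 2 * c i + g i + g (i - 1) = 0

variable {s : ℕ} {g c : ZMod s → ℤ}

theorem IsBalanced.eq_neg_one_pow (h : IsBalanced g c) (hc : ∀ i, c i = 0) (a : ZMod s)
    (k : ℕ) : g (a + k) = (-1) ^ k * g a := by
  induction k with
  | zero => simp
  | succ k ih =>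
    have := h (a + (k + 1 : ℕ))
    rw [hc, show a + ((k + 1 : ℕ) : ZMod s) - 1 = a + k by push_cast; ring, ih] at this
    rw [pow_succ]
    linarith

variable [NeZero s]

theorem exists_isBalanced_path (a : ZMod s) {p : ℕ} (hp : 0 < p) (hps : p < s) :
    ∃ g c : ZMod s → ℤ, IsBalanced g c ∧ (∀ i, p ≤ (i - a).val → g i = 0) ∧
      (∀ i, i ≠ a → i ≠ a + p → c i = 0) ∧ |c a| = 1 ∧
      ∑ i, |g i| ≤ 2 * (s - 1) ∧ ∑ i, |c i| ≤ 2 := by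
  have hpa : a ≠ a + p := by
    intro h
    have h1 : ((p : ℕ) : ZMod s) = 0 := by simpa using h.symm
    have h2 := ZMod.val_natCast_of_lt hps
    rw [h1, ZMod.val_zero] at h2
    omega
  refine ⟨fun i => if (i - a).val < p then 2 * (-1) ^ (i - a).val else 0,
    fun i => if i = a then -1 else if i = a + p then (-1) ^ p else 0, fun i => ?_, fun i hi => ?_,
    fun i h1 h2 => ?_, ?_, ?_, ?_⟩
  · dsimp only
    by_cases hi : i = a
    · subst hi
      rw [if_pos rfl, sub_self, show i - 1 - i = 0 - 1 by ring, ZMod.val_zero_sub_one,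
        ZMod.val_zero, if_pos hp, if_neg (by omega)]
      norm_num
    · have hia : i - a ≠ 0 := sub_ne_zero.2 hi
      rw [if_neg hi, show i - 1 - a = i - a - 1 by ring, ZMod.val_sub_one_of_ne_zero hia]
      obtain ⟨m, hm⟩ := Nat.exists_eq_succ_of_ne_zero ((ZMod.val_ne_zero _).2 hia)
      have hip : i = a + p ↔ m + 1 = p := by
        rw [← Nat.succ_eq_add_one, ← hm]
        constructor
        · rintro rfl
          rw [add_sub_cancel_left, ZMod.val_natCast_of_lt hps]
        · intro h
          rw [← h, ZMod.natCast_zmod_val]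
          ring
      simp only [hip, hm, Nat.succ_eq_add_one, Nat.add_sub_cancel]
      rcases lt_trichotomy (m + 1) p with h | h | h
      · rw [if_neg (by omega), if_pos h, if_pos (by omega)]
        ring
      · subst h
        rw [if_pos rfl, if_neg (by omega), if_pos (by omega)]
        ring
      · rw [if_neg (by omega), if_neg (by omega), if_neg (by omega)]
        rfl
  · exact if_neg (by omega)
  · dsimp only
    rw [if_neg h1, if_neg h2]
  · simp
  · calc _ ≤ ∑ i : ZMod s, ((2 : ℤ) - if i = a - 1 then 2 else 0) := by
          refine Finset.sum_le_sum fun i _ => ?_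
          dsimp only
          by_cases hi : i = a - 1
          · subst hi
            rw [show a - 1 - a = 0 - 1 by ring, ZMod.val_zero_sub_one, if_neg (by omega)]
            simp
          · rw [if_neg hi]
            split_ifs <;> simp [abs_mul]
      _ = 2 * (s - 1) := by
          rw [Finset.sum_sub_distrib]
          simp [ZMod.card]
          ring
  · calc _ ≤ ∑ i : ZMod s, ((if i = a then (1 : ℤ) else 0) + if i = a + p then 1 else 0) := by
          refine Finset.sum_le_sum fun i _ => ?_
          dsimp only
          by_cases h1 : i = a
          · simp [h1, hpa]
          · rw [if_neg h1, if_neg h1]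
            split_ifs <;> simp
      _ ≤ 2 := by
          rw [Finset.sum_add_distrib]
          simp

theorem exists_isBalanced_cycle (a : ZMod s) :
    ∃ g c : ZMod s → ℤ, IsBalanced g c ∧ (∀ i, i ≠ a → c i = 0) ∧ (Even s → c a = 0) ∧
      |g a| = 1 ∧ ∑ i, |g i| ≤ s ∧ ∑ i, |c i| ≤ 1 := by
  refine ⟨fun i => (-1) ^ (i - a).val, fun i => if i = a then (if Even s then 0 else -1) else 0,
    fun i => ?_, fun i h => if_neg h, fun h => by simp [h], by simp, ?_, ?_⟩
  · dsimp only
    have hs := Nat.pos_of_ne_zero (NeZero.ne s)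
    by_cases hi : i = a
    · subst hi
      rw [if_pos rfl, sub_self, show i - 1 - i = 0 - 1 by ring, ZMod.val_zero_sub_one,
        ZMod.val_zero]
      split_ifs with h
      · rw [Odd.neg_one_pow (Nat.Even.sub_odd hs h odd_one)]
        norm_num
      · rw [Even.neg_one_pow (Nat.Odd.sub_odd (Nat.not_even_iff_odd.1 h) odd_one)]
        norm_num
    · have hia : i - a ≠ 0 := sub_ne_zero.2 hi
      rw [if_neg hi, show i - 1 - a = i - a - 1 by ring, ZMod.val_sub_one_of_ne_zero hia]
      obtain ⟨m, hm⟩ := Nat.exists_eq_succ_of_ne_zero ((ZMod.val_ne_zero _).2 hia)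
      rw [hm, Nat.succ_eq_add_one, Nat.add_sub_cancel]
      ring
  · simp [ZMod.card]
  · calc _ ≤ ∑ i : ZMod s, (if i = a then (1 : ℤ) else 0) := by
          refine Finset.sum_le_sum fun i _ => ?_
          dsimp only
          split_ifs <;> simp
      _ ≤ 1 := by simp

theorem IsBalanced.exists_small (h : IsBalanced g c) (hg : ∃ i, g i ≠ 0) {l : ℕ} (hs : 2 ≤ s)
    (hl : 1 ≤ l) :
    ∃ g' c' : ZMod s → ℤ, IsBalanced g' c' ∧ (∀ i, g i = 0 → g' i = 0) ∧
      (∀ i, c i = 0 → c' i = 0) ∧ (∃ i, |g' i| = 1 ∨ |c' i| = 1) ∧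
      ∑ i, |g' i| + l * ∑ i, |c' i| ≤ 2 * ((l + s - 1 : ℕ) : ℤ) := by
  by_cases hz : ∃ z, g z = 0
  · obtain ⟨z, hz⟩ := hz
    obtain ⟨a, ha0, ha⟩ : ∃ a, g (a - 1) = 0 ∧ g a ≠ 0 := by
      by_contra! H
      obtain ⟨i, hi⟩ := hg
      refine hi (ZMod.induction_add_one (P := fun i => g i = 0) z hz (fun i hi => ?_) i)
      exact H (i + 1) (by simpa using hi)
    have hex : ∃ n : ℕ, g (a + n) = 0 := by
      refine ⟨s - 1, ?_⟩
      rw [Nat.cast_sub (by omega), ZMod.natCast_self]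
      simpa [sub_eq_add_neg] using ha0
    classical
    obtain ⟨p, hp0, hpmin⟩ : ∃ p : ℕ, g (a + p) = 0 ∧ ∀ m < p, g (a + m) ≠ 0 :=
      ⟨Nat.find hex, Nat.find_spec hex, fun m hm => Nat.find_min hex hm⟩
    have hp : 0 < p := by
      rcases Nat.eq_zero_or_pos p with rfl | h
      · exact absurd (by simpa using hp0) ha
      · exact h
    have hps : p < s := by
      by_contra! H
      refine hpmin (s - 1) (by omega) ?_
      rw [Nat.cast_sub (by omega), ZMod.natCast_self]
      simpa [sub_eq_add_neg] using ha0
    obtain ⟨g', c', hb, hg', hc', hca, hsg, hsc⟩ := exists_isBalanced_path a hp hps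
    refine ⟨g', c', hb, fun i hi => hg' i ?_, fun i hi => hc' i ?_ ?_, ⟨a, Or.inr hca⟩, ?_⟩
    · by_contra! H
      refine hpmin _ H ?_
      rwa [ZMod.natCast_zmod_val, add_sub_cancel]
    · rintro rfl
      have := h i
      rw [hi, ha0] at this
      omega
    · rintro rfl
      have := h (a + p)
      refine hpmin (p - 1) (by omega) ?_
      rw [hi, hp0] at this
      rw [Nat.cast_sub (by omega), Nat.cast_one, ← add_sub_assoc]
      omega
    · have : (l : ℤ) * ∑ i, |c' i| ≤ l * 2 := mul_le_mul_of_nonneg_left hsc (by positivity)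
      omega
  · push Not at hz
    obtain ⟨a, ha⟩ : ∃ a, Even s ∨ c a ≠ 0 := by
      by_contra! H
      have := h.eq_neg_one_pow (fun i => (H i).2) 0 s
      rw [Odd.neg_one_pow (Nat.not_even_iff_odd.1 (H 0).1), ZMod.natCast_self, add_zero] at this
      exact hz 0 (by omega)
    obtain ⟨g', c', hb, hc', hce, hga, hsg, hsc⟩ := exists_isBalanced_cycle a
    refine ⟨g', c', hb, fun i hi => absurd hi (hz i), fun i hi => ?_, ⟨a, Or.inl hga⟩, ?_⟩
    · by_cases hia : i = a
      · subst hia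
        exact hce (ha.resolve_right (not_not.2 hi))
      · exact hc' i hia
    · have : (l : ℤ) * ∑ i, |c' i| ≤ l * 1 := mul_le_mul_of_nonneg_left hsc (by positivity)
      omega

end CyclicSequences

section GraphToricIdeals

variable {G : SimpleGraph V}

/-- The indicator vector of the two endpoints of an edge. -/
def endpointsExp (e : Sym2 V) : V →₀ ℕ :=
  Sym2.lift ⟨fun a b => Finsupp.single a 1 + Finsupp.single b 1, fun _ _ => add_comm _ _⟩ e

theorem edgeImage_eq_monomial (e : Sym2 V) : edgeImage K e = monomial (endpointsExp e) 1 := by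
  induction e with
  | _ a b => simp [edgeImage, endpointsExp, X, monomial_mul]

theorem binom_mem_graphToricIdeal_iff (u v : G.edgeSet →₀ ℕ) :
    binom K u v ∈ graphToricIdeal K G ↔
      (u.sum fun e n => n • endpointsExp (e : Sym2 V)) =
        v.sum fun e n => n • endpointsExp (e : Sym2 V) := by
  have key : ∀ u : G.edgeSet →₀ ℕ,
      aeval (fun e : G.edgeSet => edgeImage K (e : Sym2 V)) (monomial u (1 : K)) =
        monomial (u.sum fun e n => n • endpointsExp (e : Sym2 V)) 1 := by
    intro u
    rw [aeval_monomial, map_one, one_mul, Finsupp.sum, monomial_sum_one]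
    refine Finset.prod_congr rfl fun e _ => ?_
    dsimp only
    rw [edgeImage_eq_monomial, monomial_pow, one_pow]
  rw [graphToricIdeal, RingHom.mem_ker, binom]
  change aeval _ _ = _ ↔ _
  rw [map_sub, key, key, sub_eq_zero]
  exact (monomial_left_injective one_ne_zero).eq_iff

theorem graphToricIdeal_ne_top : graphToricIdeal K G ≠ ⊤ := RingHom.ker_ne_top _

end GraphToricIdeals

section Gsl

variable {s l : ℕ}

/-- The edges of `Gsl s l`: those of the central cycle, followed by those of the outer cycles. -/
def gslEdge : ZMod s ⊕ ZMod s × ZMod l → Sym2 (ZMod s × ZMod l)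
  | Sum.inl i => s((i, 0), (i + 1, 0))
  | Sum.inr (i, j) => s((i, j), (i, j + 1))

theorem ZMod.natCast_ne_zero_of_lt {n k : ℕ} (hk : 0 < k) (hkn : k < n) :
    (k : ZMod n) ≠ 0 := by
  intro h
  have := Nat.le_of_dvd hk ((ZMod.natCast_eq_zero_iff k n).1 h)
  omega

theorem ZMod.add_one_ne_self {n : ℕ} (hn : 2 ≤ n) (i : ZMod n) : i + 1 ≠ i := by
  have := ZMod.natCast_ne_zero_of_lt one_pos hn
  simpa using this

theorem ZMod.eq_of_pair_add_one {n : ℕ} (hn : 3 ≤ n) {i j : ZMod n}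
    (h : i = j ∧ i + 1 = j + 1 ∨ i = j + 1 ∧ i + 1 = j) : i = j := by
  rcases h with h | ⟨h1, h2⟩
  · exact h.1
  · have := ZMod.natCast_ne_zero_of_lt two_pos hn
    refine absurd ?_ this
    push_cast
    linear_combination h2 - h1

theorem gslEdge_injective (hs : 3 ≤ s) (hl : 3 ≤ l) :
    Function.Injective (gslEdge (s := s) (l := l)) := by
  have h1 := ZMod.add_one_ne_self (show 2 ≤ s by omega)
  have h2 := ZMod.add_one_ne_self (show 2 ≤ l by omega)
  rintro (i | ⟨i, j⟩) (i' | ⟨i', j'⟩) h <;>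
    simp only [gslEdge, Sym2.eq_iff, Prod.mk.injEq] at h
  · simpa using ZMod.eq_of_pair_add_one hs (by tauto)
  · exact absurd (by grind : i + 1 = i) (h1 i)
  · exact absurd (by grind : i' + 1 = i') (h1 i')
  · obtain rfl : i = i' := by tauto
    simpa using ZMod.eq_of_pair_add_one hl (by tauto)

theorem gslEdge_mem (hs : 3 ≤ s) (hl : 3 ≤ l) (x : ZMod s ⊕ ZMod s × ZMod l) :
    gslEdge x ∈ (Gsl s l).edgeSet := by
  have h1 := ZMod.add_one_ne_self (show 2 ≤ s by omega)
  have h2 := ZMod.add_one_ne_self (show 2 ≤ l by omega)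
  rw [Gsl, SimpleGraph.edgeSet_fromEdgeSet]
  rcases x with i | ⟨i, j⟩
  · refine ⟨Or.inl ⟨i, rfl⟩, ?_⟩
    simpa [gslEdge] using (h1 i).symm
  · refine ⟨Or.inr ⟨i, j, rfl⟩, ?_⟩
    simpa [gslEdge] using (h2 j).symm

/-- The enumeration of the edges of `Gsl s l` by `gslEdge`. -/
def gslEquiv (hs : 3 ≤ s) (hl : 3 ≤ l) :
    ZMod s ⊕ ZMod s × ZMod l ≃ (Gsl s l).edgeSet :=
  Equiv.ofBijective (fun x => ⟨gslEdge x, gslEdge_mem hs hl x⟩)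
    ⟨fun x y h => gslEdge_injective hs hl (congrArg Subtype.val h), by
      rintro ⟨e, he⟩
      rw [Gsl, SimpleGraph.edgeSet_fromEdgeSet] at he
      obtain ⟨⟨i, rfl⟩ | ⟨i, j, rfl⟩, -⟩ := he
      · exact ⟨Sum.inl i, rfl⟩
      · exact ⟨Sum.inr (i, j), rfl⟩⟩

theorem coe_gslEquiv (hs : 3 ≤ s) (hl : 3 ≤ l) (x : ZMod s ⊕ ZMod s × ZMod l) :
    (gslEquiv hs hl x : Sym2 (ZMod s × ZMod l)) = gslEdge x := rfl

/-- The integer kernel of the vertex-edge incidence matrix of `Gsl s l`. -/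
def gslLattice (s l : ℕ) : AddSubgroup (ZMod s ⊕ ZMod s × ZMod l → ℤ) where
  carrier := {d | ∀ i j, d (.inr (i, j)) + d (.inr (i, j - 1)) +
    (if j = 0 then d (.inl i) + d (.inl (i - 1)) else 0) = 0}
  zero_mem' := by simp
  add_mem' := by
    intro a b ha hb i j
    have h1 := ha i j
    have h2 := hb i j
    simp only [Pi.add_apply]
    split_ifs at h1 h2 ⊢ <;> linarith
  neg_mem' := by
    intro a ha i j
    have h1 := ha i j
    simp only [Pi.neg_apply]
    split_ifs at h1 ⊢ <;> linarith

theorem mem_gslLattice {d : ZMod s ⊕ ZMod s × ZMod l → ℤ} :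
    d ∈ gslLattice s l ↔ ∀ i j, d (.inr (i, j)) + d (.inr (i, j - 1)) +
      (if j = 0 then d (.inl i) + d (.inl (i - 1)) else 0) = 0 := Iff.rfl

theorem sum_endpointsExp_gslEdge [NeZero s] [NeZero l] (d : ZMod s ⊕ ZMod s × ZMod l → ℕ)
    (i : ZMod s) (j : ZMod l) :
    ∑ x, d x * endpointsExp (gslEdge x) (i, j) = d (.inr (i, j)) + d (.inr (i, j - 1)) +
      if j = 0 then d (.inl i) + d (.inl (i - 1)) else 0 := by
  have hj : ∀ (k : ZMod l), k + 1 = j ↔ k = j - 1 := fun k => eq_sub_iff_add_eq.symm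
  have hi : ∀ (k : ZMod s), k + 1 = i ↔ k = i - 1 := fun k => eq_sub_iff_add_eq.symm
  rw [Fintype.sum_sum_type, Fintype.sum_prod_type]
  simp only [gslEdge, endpointsExp, Sym2.lift_mk, Finsupp.add_apply, Finsupp.single_apply,
    Prod.mk.injEq, hi, hj, ite_and, mul_add, mul_ite, mul_one, mul_zero, Finset.sum_add_distrib,
    Finset.sum_ite_irrel, Finset.sum_const_zero, Finset.sum_ite_eq', Finset.mem_univ, if_true,
    eq_comm (a := (0 : ZMod l))]
  split_ifs <;> ring

theorem binom_mem_graphToricIdeal_Gsl_iff [NeZero s] [NeZero l] (hs : 3 ≤ s) (hl : 3 ≤ l)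
    (u v : (Gsl s l).edgeSet →₀ ℕ) :
    binom K u v ∈ graphToricIdeal K (Gsl s l) ↔
      (fun x => (u (gslEquiv hs hl x) : ℤ) - v (gslEquiv hs hl x)) ∈ gslLattice s l := by
  have key : ∀ (u : (Gsl s l).edgeSet →₀ ℕ) (i : ZMod s) (j : ZMod l),
      (u.sum fun e n => n • endpointsExp (e : Sym2 (ZMod s × ZMod l))) (i, j) =
        u (gslEquiv hs hl (.inr (i, j))) + u (gslEquiv hs hl (.inr (i, j - 1))) +
      if j = 0 then u (gslEquiv hs hl (.inl i)) + u (gslEquiv hs hl (.inl (i - 1))) else 0 := by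
    intro u i j
    let _ := Fintype.ofEquiv _ (gslEquiv hs hl)
    rw [← sum_endpointsExp_gslEdge (fun x => u (gslEquiv hs hl x)),
      Finsupp.sum_fintype _ _ (by simp), Finsupp.finsetSum_apply,
      ← Equiv.sum_comp (gslEquiv hs hl)]
    rfl
  rw [binom_mem_graphToricIdeal_iff, mem_gslLattice, DFunLike.ext_iff, Prod.forall]
  refine forall₂_congr fun i j => ?_
  rw [key, key]
  split_ifs <;> omega

theorem sum_eq_zero_of_mem_gslLattice [NeZero s] [NeZero l]
    {d : ZMod s ⊕ ZMod s × ZMod l → ℤ} (hd : d ∈ gslLattice s l) : ∑ x, d x = 0 := by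
  have h : ∑ i, ∑ j, (d (.inr (i, j)) + d (.inr (i, j - 1)) +
      (if j = 0 then d (.inl i) + d (.inl (i - 1)) else 0)) = 0 :=
    Finset.sum_eq_zero fun i _ => Finset.sum_eq_zero fun j _ => hd i j
  have h1 : ∀ i, ∑ j : ZMod l, d (.inr (i, j - 1)) = ∑ j : ZMod l, d (.inr (i, j)) :=
    fun i => Equiv.sum_comp (Equiv.subRight (1 : ZMod l)) fun j => d (.inr (i, j))
  have h2 : ∑ i : ZMod s, d (.inl (i - 1)) = ∑ i : ZMod s, d (.inl i) :=
    Equiv.sum_comp (Equiv.subRight (1 : ZMod s)) fun i => d (.inl i)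
  simp only [Finset.sum_add_distrib, h1, h2, Finset.sum_ite_eq', Finset.mem_univ, if_true] at h
  rw [Fintype.sum_sum_type, Fintype.sum_prod_type]
  linarith

theorem inr_eq_of_mem_gslLattice [NeZero l] {d : ZMod s ⊕ ZMod s × ZMod l → ℤ}
    (hd : d ∈ gslLattice s l) (i : ZMod s) (j : ZMod l) :
    d (.inr (i, j)) = (-1) ^ j.val * d (.inr (i, 0)) := by
  have key : ∀ k < l, d (.inr (i, (k : ZMod l))) = (-1) ^ k * d (.inr (i, 0)) := by
    intro k
    induction k with
    | zero => simp
    | succ k ih =>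
      intro hk
      have h := hd i ((k + 1 : ℕ) : ZMod l)
      rw [if_neg (ZMod.natCast_ne_zero_of_lt k.succ_pos hk),
        show ((k + 1 : ℕ) : ZMod l) - 1 = k by push_cast; ring, ih (by omega)] at h
      rw [pow_succ]
      linarith
  simpa using key j.val j.val_lt

theorem isBalanced_of_mem_gslLattice [NeZero l] (hodd : Odd l)
    {d : ZMod s ⊕ ZMod s × ZMod l → ℤ} (hd : d ∈ gslLattice s l) :
    IsBalanced (fun i => d (.inl i)) fun i => d (.inr (i, 0)) := by
  intro i
  have h := hd i 0
  rw [if_pos rfl, inr_eq_of_mem_gslLattice hd i (0 - 1), ZMod.val_zero_sub_one,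
    Even.neg_one_pow (Nat.Odd.sub_odd hodd odd_one)] at h
  linarith

/-- The vector on the edges of `Gsl s l` with value `g i` on the `i`-th edge of the central
cycle and alternating values `c i, -c i, …, c i` on the `i`-th outer cycle. -/
def gslVector (l : ℕ) (g c : ZMod s → ℤ) : ZMod s ⊕ ZMod s × ZMod l → ℤ :=
  Sum.elim g fun p => (-1) ^ p.2.val * c p.1

theorem gslVector_mem [NeZero l] (hodd : Odd l) {g c : ZMod s → ℤ} (h : IsBalanced g c) :
    gslVector l g c ∈ gslLattice s l := by
  intro i j
  simp only [gslVector, Sum.elim_inl, Sum.elim_inr]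
  by_cases hj : j = 0
  · subst hj
    rw [if_pos rfl, ZMod.val_zero_sub_one, ZMod.val_zero,
      Even.neg_one_pow (Nat.Odd.sub_odd hodd odd_one)]
    linarith [h i]
  · rw [if_neg hj, ZMod.val_sub_one_of_ne_zero hj]
    obtain ⟨m, hm⟩ := Nat.exists_eq_succ_of_ne_zero ((ZMod.val_ne_zero _).2 hj)
    rw [hm, Nat.succ_eq_add_one, Nat.add_sub_cancel]
    ring

theorem sum_abs_gslVector [NeZero s] [NeZero l] (g c : ZMod s → ℤ) :
    ∑ x, |gslVector l g c x| = ∑ i, |g i| + l * ∑ i, |c i| := by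
  rw [Fintype.sum_sum_type, Fintype.sum_prod_type]
  simp [gslVector, abs_mul, ZMod.card, Finset.mul_sum]

theorem totalDegree_le_of_isCircuitBinomial_Gsl (hs : 3 ≤ s) (hl : 3 ≤ l) (hodd : Odd l)
    {f : MvPolynomial (Gsl s l).edgeSet K}
    (hf : IsCircuitBinomial (graphToricIdeal K (Gsl s l)) f) : f.totalDegree ≤ l + s - 1 := by
  have : NeZero s := ⟨by omega⟩
  have : NeZero l := ⟨by omega⟩
  set ε := gslEquiv hs hl
  let _ := Fintype.ofEquiv _ ε
  obtain ⟨d, hd, hd0, H⟩ := IsCircuitBinomial.exists_totalDegree_le graphToricIdeal_ne_top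
    (L := (gslLattice s l).comap (LinearMap.funLeft ℤ ℤ ε).toAddMonoidHom)
    (binom_mem_graphToricIdeal_Gsl_iff hs hl) hf
  replace hd : (fun x => d (ε x)) ∈ gslLattice s l := hd
  have hbal := isBalanced_of_mem_gslLattice hodd hd
  have hg : ∃ i, d (ε (.inl i)) ≠ 0 := by
    by_contra! hg
    apply hd0
    have hx : ∀ x, d (ε x) = 0 := by
      rintro (i | ⟨i, j⟩)
      · exact hg i
      · rw [inr_eq_of_mem_gslLattice hd i j]
        have := hbal i
        simp only [hg] at this
        rw [show d (ε (.inr (i, 0))) = 0 by omega, mul_zero]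
    ext e
    simpa using hx (ε.symm e)
  obtain ⟨g, c, hgc, hg', hc', ⟨i, hi⟩, hsum⟩ := hbal.exists_small hg (by omega) (by omega : 1 ≤ l)
  have hmem := gslVector_mem hodd hgc
  have hunit : ∃ x, |gslVector l g c x| = 1 := by
    rcases hi with hi | hi
    · exact ⟨.inl i, hi⟩
    · exact ⟨.inr (i, 0), by simpa [gslVector] using hi⟩
  obtain ⟨x₀, hx₀⟩ := hunit
  have hunit' : |gslVector l g c (ε.symm (ε x₀))| = 1 := by rwa [ε.symm_apply_apply]
  refine (H (fun e => gslVector l g c (ε.symm e)) ?_ (fun e he => ?_) ⟨ε x₀, hunit'⟩).trans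
    (totalDegree_binom_posExp_le ?_ ?_ ?_)
  · change (fun x => gslVector l g c (ε.symm (ε x))) ∈ gslLattice s l
    simpa using hmem
  · obtain ⟨x, rfl⟩ := ε.surjective e
    rw [ε.symm_apply_apply]
    rcases x with i | ⟨i, j⟩
    · exact hg' i he
    · have h0 := inr_eq_of_mem_gslLattice hd i j
      rw [he, eq_comm, mul_eq_zero] at h0
      have := hc' i (h0.resolve_left (pow_ne_zero _ (by norm_num)))
      simp [gslVector, this]
  · intro h0
    have := congrFun h0 (ε x₀)
    simp only [Pi.zero_apply] at this
    rw [this] at hunit'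
    simp at hunit'
  · rw [Equiv.sum_comp ε.symm (gslVector l g c)]
    exact sum_eq_zero_of_mem_gslLattice hmem
  · rw [Equiv.sum_comp ε.symm fun x => |gslVector l g c x|, sum_abs_gslVector]
    exact hsum

theorem EvenClosedWalk.sum_plusExp {G : SimpleGraph V} (w : EvenClosedWalk G) :
    (w.plusExp.sum fun _ n => n) = w.q := by
  change w.plusExp.degree = w.q
  simp [plusExp, map_sum]

theorem EvenClosedWalk.sum_minusExp {G : SimpleGraph V} (w : EvenClosedWalk G) :
    (w.minusExp.sum fun _ n => n) = w.q := by
  change w.minusExp.degree = w.q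
  simp [minusExp, map_sum]

theorem EvenClosedWalk.plusExp_eq_ite {G : SimpleGraph V} (w : EvenClosedWalk G)
    {e : G.edgeSet} {p : ℕ} (hp : p < 2 * w.q) (he : ∀ t h, w.edge t h = e ↔ t = p) :
    w.plusExp e = if Even p then 1 else 0 := by
  classical
  rw [plusExp, Finsupp.finsetSum_apply]
  simp only [Finsupp.single_apply, he]
  split_ifs with hev
  · obtain ⟨m, rfl⟩ := hev
    rw [Finset.sum_eq_single (⟨m, by omega⟩ : Fin w.q)]
    · rw [if_pos (by simp only; omega)]
    · intro k _ hk
      rw [if_neg fun h => hk (Fin.ext (by simp only; omega))]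
    · simp
  · exact Finset.sum_eq_zero fun k _ => if_neg fun h => hev ⟨k, by omega⟩

theorem EvenClosedWalk.minusExp_eq_ite {G : SimpleGraph V} (w : EvenClosedWalk G)
    {e : G.edgeSet} {p : ℕ} (hp : p < 2 * w.q) (he : ∀ t h, w.edge t h = e ↔ t = p) :
    w.minusExp e = if Even p then 0 else 1 := by
  classical
  rw [minusExp, Finsupp.finsetSum_apply]
  simp only [Finsupp.single_apply, he]
  split_ifs with hev
  · obtain ⟨m, rfl⟩ := hev
    exact Finset.sum_eq_zero fun k _ => if_neg fun h => by omega
  · obtain ⟨m, rfl⟩ := Nat.not_even_iff_odd.1 hev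
    rw [Finset.sum_eq_single (⟨m, by omega⟩ : Fin w.q)]
    · rw [if_pos (by simp only)]
    · intro k _ hk
      rw [if_neg fun h => hk (Fin.ext (by simp only; omega))]
    · simp

/-- The vertex at time `t` of the walk on `Gsl s l` that goes around the outer cycles one after
the other, following an edge of the central cycle after each of them. -/
def gslWalkVert (s l t : ℕ) : ZMod s × ZMod l := ((t / (l + 1) : ℕ), (t % (l + 1) : ℕ))

theorem gslWalkVert_mul_add (k : ℕ) {r : ℕ} (hr : r < l + 1) :
    gslWalkVert s l (k * (l + 1) + r) = ((k : ZMod s), (r : ZMod l)) := by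
  rw [gslWalkVert, mul_comm, Nat.mul_add_div (Nat.succ_pos l), Nat.mul_add_mod,
    Nat.div_eq_of_lt hr, Nat.mod_eq_of_lt hr, add_zero]

/-- The time at which the walk `gslWalkVert` traverses an edge of `Gsl s l`. -/
def gslWalkTime : ZMod s ⊕ ZMod s × ZMod l → ℕ
  | Sum.inl i => i.val * (l + 1) + l
  | Sum.inr (i, j) => i.val * (l + 1) + j.val

theorem gslWalkTime_lt [NeZero s] [NeZero l] (x : ZMod s ⊕ ZMod s × ZMod l) :
    gslWalkTime x < s * (l + 1) := by
  have key : ∀ (i : ZMod s) (r : ℕ), r < l + 1 → i.val * (l + 1) + r < s * (l + 1) := by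
    intro i r hr
    have : (i.val + 1) * (l + 1) ≤ s * (l + 1) := Nat.mul_le_mul_right _ i.val_lt
    linarith
  rcases x with i | ⟨i, j⟩
  · exact key i l (by omega)
  · exact key i j.val (by have := j.val_lt; omega)

theorem exists_gslWalkTime_eq [NeZero l] {t : ℕ} (ht : t < s * (l + 1)) :
    ∃ x : ZMod s ⊕ ZMod s × ZMod l, gslWalkTime x = t := by
  have h1 : t / (l + 1) < s := Nat.div_lt_of_lt_mul (by rwa [mul_comm])
  have h2 : t % (l + 1) < l + 1 := Nat.mod_lt _ (Nat.succ_pos l)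
  have h3 := Nat.div_add_mod' t (l + 1)
  rcases Nat.lt_succ_iff_lt_or_eq.1 h2 with h | h
  · refine ⟨.inr ((t / (l + 1) : ℕ), (t % (l + 1) : ℕ)), ?_⟩
    rw [gslWalkTime, ZMod.val_natCast_of_lt h1, ZMod.val_natCast_of_lt h, h3]
  · refine ⟨.inl (t / (l + 1) : ℕ), ?_⟩
    rw [gslWalkTime, ZMod.val_natCast_of_lt h1]
    omega

theorem mk_gslWalkVert_gslWalkTime [NeZero s] [NeZero l] (x : ZMod s ⊕ ZMod s × ZMod l) :
    s(gslWalkVert s l (gslWalkTime x), gslWalkVert s l (gslWalkTime x + 1)) = gslEdge x := by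
  rcases x with i | ⟨i, j⟩
  · have h : i.val * (l + 1) + l + 1 = (i.val + 1) * (l + 1) + 0 := by ring
    rw [gslWalkTime, h, gslWalkVert_mul_add _ (by omega), gslWalkVert_mul_add _ (by omega)]
    simp [gslEdge]
  · have := j.val_lt
    rw [gslWalkTime, add_assoc, gslWalkVert_mul_add _ (by omega),
      gslWalkVert_mul_add _ (by omega)]
    simp [gslEdge]

theorem mk_gslWalkVert_eq_gslEdge_iff (hs : 3 ≤ s) (hl : 3 ≤ l) {t : ℕ} (ht : t < s * (l + 1))
    (x : ZMod s ⊕ ZMod s × ZMod l) :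
    s(gslWalkVert s l t, gslWalkVert s l (t + 1)) = gslEdge x ↔ t = gslWalkTime x := by
  have : NeZero s := ⟨by omega⟩
  have : NeZero l := ⟨by omega⟩
  constructor
  · intro h
    obtain ⟨y, rfl⟩ := exists_gslWalkTime_eq ht
    rw [mk_gslWalkVert_gslWalkTime] at h
    rw [gslEdge_injective hs hl h]
  · rintro rfl
    exact mk_gslWalkVert_gslWalkTime x

theorem two_mul_mul_succ_div_two (s : ℕ) (hodd : Odd l) :
    2 * (s * (l + 1) / 2) = s * (l + 1) :=
  Nat.two_mul_div_two_of_even (hodd.add_odd odd_one |>.mul_left s)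

/-- The closed walk on `Gsl s l` that traverses every edge exactly once, going around the outer
cycles one after the other. -/
def gslWalk (hs : 3 ≤ s) (hl : 3 ≤ l) (hodd : Odd l) : EvenClosedWalk (Gsl s l) where
  q := s * (l + 1) / 2
  verts := gslWalkVert s l
  adj t ht := by
    have : NeZero l := ⟨by omega⟩
    rw [two_mul_mul_succ_div_two s hodd] at ht
    obtain ⟨x, hx⟩ := exists_gslWalkTime_eq ht
    rw [← SimpleGraph.mem_edgeSet, (mk_gslWalkVert_eq_gslEdge_iff hs hl ht x).2 hx.symm]
    exact gslEdge_mem hs hl x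
  closed := by
    rw [two_mul_mul_succ_div_two s hodd]
    simp [gslWalkVert]

section Walk

variable (hs : 3 ≤ s) (hl : 3 ≤ l) (hodd : Odd l)

theorem two_mul_gslWalk_q : 2 * (gslWalk hs hl hodd).q = s * (l + 1) :=
  two_mul_mul_succ_div_two s hodd

theorem gslWalk_edge_eq_iff (x : ZMod s ⊕ ZMod s × ZMod l) (t : ℕ)
    (ht : t < 2 * (gslWalk hs hl hodd).q) :
    (gslWalk hs hl hodd).edge t ht = gslEquiv hs hl x ↔ t = gslWalkTime x := by
  rw [Subtype.ext_iff, coe_gslEquiv]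
  exact mk_gslWalkVert_eq_gslEdge_iff hs hl (two_mul_gslWalk_q hs hl hodd ▸ ht) x

theorem gslWalkTime_lt_two_mul_q (x : ZMod s ⊕ ZMod s × ZMod l) :
    gslWalkTime x < 2 * (gslWalk hs hl hodd).q := by
  have : NeZero s := ⟨by omega⟩
  have : NeZero l := ⟨by omega⟩
  rw [two_mul_gslWalk_q]
  exact gslWalkTime_lt x

theorem count_gslWalk (e : Sym2 (ZMod s × ZMod l)) (he : e ∈ (Gsl s l).edgeSet) :
    (gslWalk hs hl hodd).count e = 1 := by
  obtain ⟨x, hx⟩ := (gslEquiv hs hl).surjective ⟨e, he⟩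
  obtain rfl : gslEdge x = e := congrArg Subtype.val hx
  rw [EvenClosedWalk.count, Finset.card_eq_one]
  refine ⟨gslWalkTime x, Finset.ext fun t => ?_⟩
  rw [Finset.mem_filter, Finset.mem_range, Finset.mem_singleton]
  constructor
  · rintro ⟨ht, h⟩
    exact (gslWalk_edge_eq_iff hs hl hodd x t ht).1 (Subtype.ext h.symm)
  · rintro rfl
    have ht := gslWalkTime_lt_two_mul_q hs hl hodd x
    exact ⟨ht, (congrArg Subtype.val ((gslWalk_edge_eq_iff hs hl hodd x _ ht).2 rfl)).symm⟩

theorem not_even_gslWalkTime_inl {l : ℕ} (hodd : Odd l) (i : ZMod s) :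
    ¬Even (gslWalkTime (l := l) (.inl i)) := by
  rw [gslWalkTime, Nat.not_even_iff_odd]
  exact ((hodd.add_odd odd_one).mul_left _).add_odd hodd

theorem even_gslWalkTime_inr {l : ℕ} (hodd : Odd l) (i : ZMod s) (j : ZMod l) :
    Even (gslWalkTime (.inr (i, j))) ↔ Even j.val := by
  have : Even (i.val * (l + 1)) := (hodd.add_odd odd_one).mul_left _
  rw [gslWalkTime, Nat.even_add, iff_true_left this]

theorem gslWalk_plusExp (x : ZMod s ⊕ ZMod s × ZMod l) :
    (gslWalk hs hl hodd).plusExp (gslEquiv hs hl x) = if Even (gslWalkTime x) then 1 else 0 :=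
  EvenClosedWalk.plusExp_eq_ite _ (gslWalkTime_lt_two_mul_q hs hl hodd x)
    (gslWalk_edge_eq_iff hs hl hodd x)

theorem gslWalk_minusExp (x : ZMod s ⊕ ZMod s × ZMod l) :
    (gslWalk hs hl hodd).minusExp (gslEquiv hs hl x) = if Even (gslWalkTime x) then 0 else 1 :=
  EvenClosedWalk.minusExp_eq_ite _ (gslWalkTime_lt_two_mul_q hs hl hodd x)
    (gslWalk_edge_eq_iff hs hl hodd x)

theorem gslWalk_plusExp_ne_minusExp :
    (gslWalk hs hl hodd).plusExp ≠ (gslWalk hs hl hodd).minusExp := by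
  intro h
  have := DFunLike.congr_fun h (gslEquiv hs hl (.inl 0))
  rw [gslWalk_plusExp, gslWalk_minusExp] at this
  split_ifs at this

theorem totalDegree_Bw_gslWalk :
    (Bw K (gslWalk hs hl hodd)).totalDegree = s * (l + 1) / 2 := by
  rw [Bw, totalDegree_binom (gslWalk_plusExp_ne_minusExp hs hl hodd),
    EvenClosedWalk.sum_plusExp, EvenClosedWalk.sum_minusExp, max_self]
  rfl

theorem gslWalk_exp_sub_eq (x : ZMod s ⊕ ZMod s × ZMod l) :
    ((gslWalk hs hl hodd).plusExp (gslEquiv hs hl x) : ℤ) -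
      (gslWalk hs hl hodd).minusExp (gslEquiv hs hl x) =
        gslVector l (fun _ => -1) (fun _ => 1) x := by
  rw [gslWalk_plusExp, gslWalk_minusExp]
  rcases x with i | ⟨i, j⟩
  · simp [not_even_gslWalkTime_inl hodd, gslVector]
  · simp only [even_gslWalkTime_inr hodd, gslVector, Sum.elim_inr, mul_one]
    split_ifs with h
    · simp [h.neg_one_pow]
    · simp [(Nat.not_even_iff_odd.1 h).neg_one_pow]

theorem isPrimitiveBinomial_Bw_gslWalk :
    IsPrimitiveBinomial (graphToricIdeal K (Gsl s l)) (Bw K (gslWalk hs hl hodd)) := by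
  have : NeZero s := ⟨by omega⟩
  have : NeZero l := ⟨by omega⟩
  refine ⟨_, _, gslWalk_plusExp_ne_minusExp hs hl hodd, rfl, ?_, fun w z hwz hI hw hz => ?_⟩
  · rw [Bw, binom_mem_graphToricIdeal_Gsl_iff hs hl]
    simp only [gslWalk_exp_sub_eq]
    exact gslVector_mem hodd fun i => by norm_num
  rw [binom_mem_graphToricIdeal_Gsl_iff hs hl] at hI
  have hw' : ∀ x, w (gslEquiv hs hl x) ≤ if Even (gslWalkTime x) then 1 else 0 := fun x =>
    (gslWalk_plusExp hs hl hodd x) ▸ hw (gslEquiv hs hl x)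
  have hz' : ∀ x, z (gslEquiv hs hl x) ≤ if Even (gslWalkTime x) then 0 else 1 := fun x =>
    (gslWalk_minusExp hs hl hodd x) ▸ hz (gslEquiv hs hl x)
  generalize hd : (fun x => (w (gslEquiv hs hl x) : ℤ) - z (gslEquiv hs hl x)) = d at hI
  have hinr := inr_eq_of_mem_gslLattice hI
  have hbal : ∀ i, 2 * d (.inr (i, 0)) + d (.inl i) + d (.inl (i - 1)) = 0 :=
    isBalanced_of_mem_gslLattice hodd hI
  have hdx : ∀ x, (w (gslEquiv hs hl x) : ℤ) - z (gslEquiv hs hl x) = d x := congrFun hd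
  have hg : ∀ i, -1 ≤ d (.inl i) ∧ d (.inl i) ≤ 0 := by
    intro i
    have h1 := hw' (.inl i)
    have h2 := hz' (.inl i)
    have h3 := hdx (.inl i)
    rw [if_neg (not_even_gslWalkTime_inl hodd i)] at h1 h2
    omega
  have hstep : ∀ i, d (.inl i) = d (.inl 0) := by
    refine ZMod.induction_add_one 0 rfl fun i hi => ?_
    have h1 := hbal (i + 1)
    rw [add_sub_cancel_right] at h1
    have h2 := hg i
    have h3 := hg (i + 1)
    omega
  have hc : ∀ i, d (.inr (i, 0)) = -d (.inl 0) := by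
    intro i
    have := hbal i
    rw [hstep i, hstep (i - 1)] at this
    omega
  have h0 := hg 0
  have hor : d (.inl 0) = 0 ∨ d (.inl 0) = -1 := by omega
  rcases hor with h0 | h0
  · refine absurd (Finsupp.ext fun e => ?_) hwz
    obtain ⟨x, rfl⟩ := (gslEquiv hs hl).surjective e
    have := hdx x
    rcases x with i | ⟨i, j⟩
    · rw [hstep, h0] at this
      omega
    · rw [hinr, hc, h0] at this
      omega
  · have hval : ∀ x, d x = gslVector l (fun _ => -1) (fun _ => 1) x := by
      rintro (i | ⟨i, j⟩)
      · rw [hstep, h0]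
        rfl
      · rw [hinr, hc, h0]
        rfl
    have key : ∀ x, w (gslEquiv hs hl x) = (gslWalk hs hl hodd).plusExp (gslEquiv hs hl x) ∧
        z (gslEquiv hs hl x) = (gslWalk hs hl hodd).minusExp (gslEquiv hs hl x) := by
      intro x
      have h1 := hw' x
      have h2 := hz' x
      have h3 := hdx x
      have h4 := gslWalk_exp_sub_eq hs hl hodd x
      rw [hval, ← h4] at h3
      rw [gslWalk_plusExp, gslWalk_minusExp] at h3 ⊢
      split_ifs at h1 h2 h3 ⊢ <;> omega
    constructor <;> ext e <;> obtain ⟨x, rfl⟩ := (gslEquiv hs hl).surjective e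
    · exact (key x).1
    · exact (key x).2

end Walk

theorem add_sub_one_lt_mul_div_two {s l : ℕ} (hs : 3 ≤ s) (hl : 3 ≤ l) (hodd : Odd l) :
    l + s - 1 < s * (l + 1) / 2 := by
  obtain ⟨m, rfl⟩ := hodd
  rw [show s * (2 * m + 1 + 1) = s * (m + 1) * 2 by ring, Nat.mul_div_cancel _ two_pos]
  have : 3 * m ≤ s * m := Nat.mul_le_mul_right m hs
  rw [mul_add]
  omega

end Gsl

/-- For odd `l ≥ 3` and `s ≥ 3`, the Graver basis of `I_{G(s,l)}` contains a
binomial of degree `s(l+1)/2` (namely `B_w` for the walk `w` traversing every edge of `G(s,l)`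
exactly once), while every circuit of `I_{G(s,l)}` has degree at most `l + s - 1`; and
`s(l+1)/2 > l + s - 1`. -/
theorem Graver_degree_exceeds_circuit_degrees (K : Type*) [Field K] (s l : ℕ)
    (hs : 3 ≤ s) (hl : 3 ≤ l) (hodd : Odd l) :
    (∃ w : EvenClosedWalk (Gsl s l),
        (∀ e ∈ (Gsl s l).edgeSet, w.count e = 1) ∧
        IsPrimitiveBinomial (graphToricIdeal K (Gsl s l)) (Bw K w) ∧
        (Bw K w).totalDegree = s * (l + 1) / 2) ∧
    (∀ f, IsCircuitBinomial (graphToricIdeal K (Gsl s l)) f →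
        f.totalDegree ≤ l + s - 1) ∧
    l + s - 1 < s * (l + 1) / 2 := by
  exact ⟨⟨gslWalk hs hl hodd, count_gslWalk hs hl hodd, isPrimitiveBinomial_Bw_gslWalk hs hl hodd,
    totalDegree_Bw_gslWalk hs hl hodd⟩, fun _ => totalDegree_le_of_isCircuitBinomial_Gsl hs hl hodd,
    add_sub_one_lt_mul_div_two hs hl hodd⟩

end
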